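/- (q-Dixon sum, terminating form) Let n be a nonnegative integer and let q, s, b be nonzero complex numbers (write a = s², so s is a square root of a) such that (q;q)_n ≠ 0, (−s;q)_n ≠ 0, (s²q/b;q)_n ≠ 0, (s²q^{n+1};q)_n ≠ 0, and (qs;q)_n ≠ 0. Then ∑_{j=0}^{n} ((s²;q)_j (−qs;q)_j (b;q)_j (q^{-n};q)_j / ((q;q)_j (−s;q)_j (s²q/b;q)_j (s²q^{n+1};q)_j)) · (q^{n+1} s / b)^j = (s²q;q)_n (q s/b;q)_n / ((q s;q)_n (s²q/b;q)_n. -/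

import Mathlib

/-- The $q$-shifted factorial $(a;q)_m = \prod_{k=0}^{m-1}(1 - a q^k)$. -/
noncomputable def qPoch (q a : ℂ) (m : ℕ) : ℂ := ∏ k ∈ Finset.range m, (1 - a * q ^ k)

open Filter Topology

theorem qPoch_zero (q a : ℂ) : qPoch q a 0 = 1 := by simp [qPoch]

theorem qPoch_succ (q a : ℂ) (m : ℕ) : qPoch q a (m + 1) = qPoch q a m * (1 - a * q ^ m) :=
  Finset.prod_range_succ _ _

theorem qPoch_succ' (q a : ℂ) (m : ℕ) :
    qPoch q a (m + 1) = (1 - a) * qPoch q (a * q) m := by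
  rw [qPoch, Finset.prod_range_succ', pow_zero, mul_one, mul_comm, qPoch]
  congr 1
  refine Finset.prod_congr rfl fun k _ => ?_
  ring

theorem qPoch_ne_zero_iff {q a : ℂ} {m : ℕ} :
    qPoch q a m ≠ 0 ↔ ∀ k < m, 1 - a * q ^ k ≠ 0 := by
  simp [qPoch, Finset.prod_ne_zero_iff]

theorem qPoch_ne_zero_of_le {q a : ℂ} {m n : ℕ} (h : qPoch q a n ≠ 0) (hmn : m ≤ n) :
    qPoch q a m ≠ 0 :=
  qPoch_ne_zero_iff.2 fun k hk => qPoch_ne_zero_iff.1 h k (hk.trans_le hmn)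

theorem qPoch_mul_one_sub (q a : ℂ) (m : ℕ) :
    qPoch q (a * q) m * (1 - a) = qPoch q a m * (1 - a * q ^ m) := by
  rw [← qPoch_succ, qPoch_succ', mul_comm]

theorem qPoch_neg_mul {q s : ℂ} (hs : 1 + s ≠ 0) (m : ℕ) :
    qPoch q (-(q * s)) m = qPoch q (-s) m * (1 + s * q ^ m) / (1 + s) := by
  rw [eq_div_iff hs, show -(q * s) = -s * q by ring]
  linear_combination qPoch_mul_one_sub q (-s) m

theorem qPoch_zpow_neg_eq_zero {q : ℂ} (hq : q ≠ 0) (n : ℕ) :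
    qPoch q (q ^ (-(n : ℤ))) (n + 1) = 0 := by
  rw [qPoch_succ, zpow_neg, zpow_natCast, inv_mul_cancel₀ (pow_ne_zero _ hq), sub_self, mul_zero]

theorem continuous_qPoch (q : ℂ) (m : ℕ) : Continuous fun a => qPoch q a m := by
  unfold qPoch
  fun_prop

/-- The summand of the terminating $q$-Dixon sum. -/
noncomputable def qDixonTerm (q s b : ℂ) (n j : ℕ) : ℂ :=
  qPoch q (s ^ 2) j * qPoch q (-(q * s)) j * qPoch q b j * qPoch q (q ^ (-(n : ℤ))) j /
    (qPoch q q j * qPoch q (-s) j * qPoch q (s ^ 2 * q / b) j *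
      qPoch q (s ^ 2 * q ^ (n + 1)) j) * (q ^ (n + 1) * s / b) ^ j

/-- The Wilf-Zeilberger companion of `qDixonTerm`, up to a factor independent of `m`. -/
noncomputable def qDixonCert (q s b : ℂ) (n m : ℕ) : ℂ :=
  qPoch q (s ^ 2) (m + 1) * qPoch q b (m + 1) * qPoch q (q ^ (-(n : ℤ))) m /
    (qPoch q q m * qPoch q (s ^ 2 * q / b) m * qPoch q (s ^ 2 * q ^ (n + 2)) m) *
    (q ^ (n + 1) * s / b) ^ (m + 1)

theorem qDixonTerm_succ {q s b : ℂ} {n m : ℕ} (hs : 1 + s ≠ 0)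
    (h2 : qPoch q (-s) (m + 1) ≠ 0) :
    qDixonTerm q s b n (m + 1) = qDixonCert q s b n m *
      ((1 + s * q ^ (m + 1)) * (1 - q ^ (-(n : ℤ)) * q ^ m) /
        ((1 + s) * (1 - q ^ (m + 1)) * (1 - s ^ 2 * q / b * q ^ m) *
          (1 - s ^ 2 * q ^ (n + 1)))) := by
  have e4 : qPoch q (s ^ 2 * q ^ (n + 1)) (m + 1) =
      (1 - s ^ 2 * q ^ (n + 1)) * qPoch q (s ^ 2 * q ^ (n + 2)) m := by
    rw [qPoch_succ', mul_assoc, ← pow_succ]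
  rw [qDixonTerm, qDixonCert, qPoch_neg_mul hs, e4, qPoch_succ q q, qPoch_succ q (s ^ 2 * q / b),
    qPoch_succ q (q ^ _)]
  rw [show q * q ^ m = q ^ (m + 1) by ring]
  simp only [div_eq_mul_inv, mul_inv]
  linear_combination (qPoch q (s ^ 2) (m + 1) * (1 + s * q ^ (m + 1)) * (1 + s)⁻¹ *
    qPoch q b (m + 1) * (qPoch q (q ^ (-(n : ℤ))) m * (1 - q ^ (-(n : ℤ)) * q ^ m)) *
    (qPoch q q m)⁻¹ * (1 - q ^ (m + 1))⁻¹ * (qPoch q (s ^ 2 * q * b⁻¹) m)⁻¹ *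
    (1 - s ^ 2 * q * b⁻¹ * q ^ m)⁻¹ * (1 - s ^ 2 * q ^ (n + 1))⁻¹ *
    (qPoch q (s ^ 2 * q ^ (n + 2)) m)⁻¹ * (q ^ (n + 1) * s * b⁻¹) ^ (m + 1)) *
    mul_inv_cancel₀ h2

theorem qDixonTerm_succ_succ {q s b : ℂ} {n m : ℕ} (hq : q ≠ 0) (hs : 1 + s ≠ 0)
    (h2 : qPoch q (-s) (m + 1) ≠ 0) :
    qDixonTerm q s b (n + 1) (m + 1) = qDixonCert q s b n m *
      ((1 + s * q ^ (m + 1)) * (1 - q ^ (-((n + 1 : ℕ) : ℤ))) * q ^ (m + 1) /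
        ((1 + s) * (1 - q ^ (m + 1)) * (1 - s ^ 2 * q / b * q ^ m) *
          (1 - s ^ 2 * q ^ (n + 2) * q ^ m))) := by
  have eu : q ^ (-((n + 1 : ℕ) : ℤ)) * q = q ^ (-(n : ℤ)) := by
    rw [← zpow_add_one₀ hq]
    push_cast
    ring_nf
  rw [qDixonTerm, qDixonCert, qPoch_neg_mul hs, qPoch_succ q q, qPoch_succ q (s ^ 2 * q / b),
    qPoch_succ' q (q ^ _), eu, qPoch_succ q (s ^ 2 * q ^ (n + 1 + 1))]
  rw [show q * q ^ m = q ^ (m + 1) by ring,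
    show q ^ (n + 1 + 1) * s / b = q ^ (n + 1) * s / b * q by ring, mul_pow _ q]
  simp only [div_eq_mul_inv, mul_inv]
  linear_combination (qPoch q (s ^ 2) (m + 1) * (1 + s * q ^ (m + 1)) * (1 + s)⁻¹ *
    qPoch q b (m + 1) * ((1 - q ^ (-((n + 1 : ℕ) : ℤ))) * qPoch q (q ^ (-(n : ℤ))) m) *
    (qPoch q q m)⁻¹ * (1 - q ^ (m + 1))⁻¹ * (qPoch q (s ^ 2 * q * b⁻¹) m)⁻¹ *
    (1 - s ^ 2 * q * b⁻¹ * q ^ m)⁻¹ * (1 - s ^ 2 * q ^ (n + 2) * q ^ m)⁻¹ *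
    (qPoch q (s ^ 2 * q ^ (n + 2)) m)⁻¹ * (q ^ (n + 1) * s * b⁻¹) ^ (m + 1) * q ^ (m + 1)) *
    mul_inv_cancel₀ h2

theorem qDixonCert_succ (q s b : ℂ) (n m : ℕ) :
    qDixonCert q s b n (m + 1) = qDixonCert q s b n m *
      ((1 - s ^ 2 * q ^ (m + 1)) * (1 - b * q ^ (m + 1)) * (1 - q ^ (-(n : ℤ)) * q ^ m) *
        (q ^ (n + 1) * s / b) /
        ((1 - q ^ (m + 1)) * (1 - s ^ 2 * q / b * q ^ m) *
          (1 - s ^ 2 * q ^ (n + 2) * q ^ m))) := by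
  rw [qDixonCert, qDixonCert, qPoch_succ q q, qPoch_succ q (s ^ 2 * q / b),
    qPoch_succ q (q ^ _), qPoch_succ q (s ^ 2 * q ^ (n + 2)), qPoch_succ q _ (m + 1),
    qPoch_succ q b (m + 1), pow_succ _ (m + 1)]
  rw [show q * q ^ m = q ^ (m + 1) by ring]
  simp only [div_eq_mul_inv, mul_inv]
  ring

theorem sum_qDixonTerm_sub {q s b : ℂ} {n : ℕ} (hq : q ≠ 0) (hb : b ≠ 0)
    (hA : ∀ k ≤ 2 * (n + 1), 1 - s ^ 2 * q ^ k ≠ 0) (hsm : ∀ k ≤ n + 1, 1 - s * q ^ k ≠ 0)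
    (hsp : ∀ k ≤ n + 1, 1 + s * q ^ k ≠ 0)
    (h1 : qPoch q q (n + 1) ≠ 0) (h3 : qPoch q (s ^ 2 * q / b) (n + 1) ≠ 0)
    (m : ℕ) (hm : m ≤ n + 1) :
    ∑ j ∈ Finset.range (m + 1), (qDixonTerm q s b (n + 1) j -
      (1 - s ^ 2 * q ^ (n + 1)) * (1 - s * q ^ (n + 1) / b) /
        ((1 - s * q ^ (n + 1)) * (1 - s ^ 2 * q ^ (n + 1) / b)) * qDixonTerm q s b n j) =
    qDixonCert q s b n m /
      ((1 + s) * (1 - s * q ^ (n + 1)) * (1 - s ^ 2 * q ^ (n + 1) / b)) := by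
  have hs : 1 + s ≠ 0 := by simpa using hsp 0 (by omega)
  have hsQ := hsm (n + 1) le_rfl
  have h3' : ∀ k ≤ n, b - s ^ 2 * q ^ (k + 1) ≠ 0 := by
    intro k hk h
    refine qPoch_ne_zero_iff.1 h3 k (by omega) ?_
    field_simp
    linear_combination h
  have h3Q := h3' n le_rfl
  induction m with
  | zero =>
    simp only [zero_add, Finset.sum_range_one, qDixonTerm, qDixonCert, qPoch_zero, qPoch_succ,
      pow_zero, pow_one]
    generalize q ^ (n + 1) = Q at *
    have h3Q' : 1 - s ^ 2 * Q / b ≠ 0 := by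
      intro h
      apply h3Q
      field_simp at h
      linear_combination h
    field_simp
    ring
  | succ m ih =>
    have h2 : qPoch q (-s) (m + 1) ≠ 0 := qPoch_ne_zero_iff.2 fun k hk => by
      simpa using hsp k (by omega)
    rw [Finset.sum_range_succ, ih (by omega), qDixonCert_succ, qDixonTerm_succ_succ hq hs h2,
      qDixonTerm_succ hs h2]
    have a1 : 1 - q * q ^ m ≠ 0 := qPoch_ne_zero_iff.1 h1 m (by omega)
    have a3 := h3' m (by omega)
    have a4 := hA (n + 2 + m) (by omega)
    have a5 := hA (n + 1) (by omega)
    have hQ : q ^ (n + 1) ≠ 0 := pow_ne_zero _ hq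
    have eu : q ^ (-(n : ℤ)) = q / q ^ (n + 1) := by
      rw [zpow_neg, zpow_natCast, pow_succ]
      field_simp
    have eu' : q ^ (-((n + 1 : ℕ) : ℤ)) = 1 / q ^ (n + 1) := by
      rw [zpow_neg, zpow_natCast, one_div]
    rw [eu, eu']
    generalize qDixonCert q s b n m = K
    rw [show q ^ (n + 2 + m) = q ^ (n + 1) * q * q ^ m by ring] at a4
    rw [show q ^ (n + 2) = q ^ (n + 1) * q by ring]
    rw [pow_succ q m] at a3 ⊢
    rw [mul_comm] at a1
    generalize q ^ (n + 1) = Q at *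
    generalize q ^ m = x at *
    have h3Q' : 1 - s ^ 2 * Q / b ≠ 0 := by
      intro h
      apply h3Q
      field_simp at h
      linear_combination h
    have a3' : 1 - s ^ 2 * q / b * x ≠ 0 := by
      intro h
      apply a3
      field_simp at h
      linear_combination h
    have a4' : 1 - s ^ 2 * (Q * q) * x ≠ 0 := by
      intro h
      apply a4
      linear_combination h
    rw [show s ^ 2 * q / b * x = s ^ 2 * (x * q) / b by ring] at a3' ⊢
    rw [show s ^ 2 * (Q * q) * x = s ^ 2 * Q * (x * q) by ring] at a4' ⊢
    rw [show q / Q * x = x * q / Q by ring]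
    generalize x * q = y at *
    clear a4
    field_simp
    ring

theorem sum_qDixonTerm_of_generic {q s b : ℂ} (hq : q ≠ 0) (hb : b ≠ 0) (n : ℕ)
    (hA : ∀ k ≤ 2 * n, 1 - s ^ 2 * q ^ k ≠ 0)
    (h1 : qPoch q q n ≠ 0) (h3 : qPoch q (s ^ 2 * q / b) n ≠ 0) :
    ∑ j ∈ Finset.range (n + 1), qDixonTerm q s b n j =
      qPoch q (s ^ 2 * q) n * qPoch q (q * s / b) n /
        (qPoch q (q * s) n * qPoch q (s ^ 2 * q / b) n) := by
  induction n with
  | zero => simp [qDixonTerm, qPoch_zero]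
  | succ n ih =>
    have hfac : ∀ k ≤ n + 1, (1 - s * q ^ k) * (1 + s * q ^ k) ≠ 0 := fun k hk => by
      have := hA (2 * k) (by omega)
      rwa [show (1 - s * q ^ k) * (1 + s * q ^ k) = 1 - s ^ 2 * q ^ (2 * k) by ring]
    have hsum := sum_qDixonTerm_sub hq hb hA (fun k hk => left_ne_zero_of_mul (hfac k hk))
      (fun k hk => right_ne_zero_of_mul (hfac k hk)) h1 h3 (n + 1) le_rfl
    have hcert : qDixonCert q s b n (n + 1) = 0 := by
      rw [qDixonCert, qPoch_zpow_neg_eq_zero hq, mul_zero, zero_div, zero_mul]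
    have hterm : qDixonTerm q s b n (n + 1) = 0 := by
      rw [qDixonTerm, qPoch_zpow_neg_eq_zero hq, mul_zero, zero_div, zero_mul]
    rw [Finset.sum_sub_distrib, ← Finset.mul_sum, hcert, zero_div, sub_eq_zero,
      Finset.sum_range_succ (qDixonTerm q s b n), hterm, add_zero,
      ih (fun k hk => hA k (by omega)) (qPoch_ne_zero_of_le h1 n.le_succ)
        (qPoch_ne_zero_of_le h3 n.le_succ)] at hsum
    rw [hsum, div_mul_div_comm, qPoch_succ, qPoch_succ q (q * s / b), qPoch_succ q (q * s),
      qPoch_succ q (s ^ 2 * q / b)]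
    congr 1 <;> ring

theorem eventually_one_sub_sq_mul_ne_zero {s : ℂ} (hs : s ≠ 0) (c : ℂ) :
    ∀ᶠ t in 𝓝[≠] s, 1 - t ^ 2 * c ≠ 0 := by
  by_cases h : 1 - s ^ 2 * c = 0
  · have hc : c ≠ 0 := by
      rintro rfl
      simp at h
    have hne : ∀ᶠ t in 𝓝[≠] s, t ≠ -s :=
      eventually_nhdsWithin_of_eventually_nhds
        (continuousAt_id.eventually_ne (self_ne_neg.2 hs))
    filter_upwards [hne, self_mem_nhdsWithin] with t ht hts h'
    have : t ^ 2 = s ^ 2 := mul_right_cancel₀ hc (by linear_combination h - h')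
    exact (sq_eq_sq_iff_eq_or_eq_neg.1 this).elim hts ht
  · have hcont : ContinuousAt (fun t : ℂ => 1 - t ^ 2 * c) s := by fun_prop
    exact eventually_nhdsWithin_of_eventually_nhds (hcont.eventually_ne h)

/-- Terminating $q$-Dixon sum, with $a = s^2$. -/
theorem q_dixon (n : ℕ) (q s b : ℂ) (hq : q ≠ 0) (hs : s ≠ 0) (hb : b ≠ 0)
    (h1 : qPoch q q n ≠ 0) (h2 : qPoch q (-s) n ≠ 0)
    (h3 : qPoch q (s ^ 2 * q / b) n ≠ 0) (h4 : qPoch q (s ^ 2 * q ^ (n + 1)) n ≠ 0)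
    (h5 : qPoch q (q * s) n ≠ 0) :
    ∑ j ∈ Finset.range (n + 1),
      qPoch q (s ^ 2) j * qPoch q (-(q * s)) j * qPoch q b j * qPoch q (q ^ (-(n : ℤ))) j /
        (qPoch q q j * qPoch q (-s) j * qPoch q (s ^ 2 * q / b) j *
          qPoch q (s ^ 2 * q ^ (n + 1)) j) * (q ^ (n + 1) * s / b) ^ j
    = qPoch q (s ^ 2 * q) n * qPoch q (q * s / b) n /
        (qPoch q (q * s) n * qPoch q (s ^ 2 * q / b) n) := by
  have hP : ∀ (f : ℂ → ℂ) (m : ℕ), Continuous f → Continuous fun t => qPoch q (f t) m :=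
    fun f m hf => (continuous_qPoch q m).comp hf
  have hL : ContinuousAt (fun t => ∑ j ∈ Finset.range (n + 1), qDixonTerm q t b n j) s := by
    refine tendsto_finsetSum _ fun j hj => ?_
    have hj : j ≤ n := Nat.lt_succ_iff.1 (Finset.mem_range.1 hj)
    refine ContinuousAt.mul (ContinuousAt.div (Continuous.continuousAt ?_)
      (Continuous.continuousAt ?_) ?_) (by fun_prop)
    · exact (((hP _ _ (by fun_prop)).mul (hP _ _ (by fun_prop))).mul continuous_const).mul
        continuous_const
    · exact ((continuous_const.mul (hP _ _ (by fun_prop))).mul (hP _ _ (by fun_prop))).mul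
        (hP _ _ (by fun_prop))
    · exact mul_ne_zero (mul_ne_zero (mul_ne_zero (qPoch_ne_zero_of_le h1 hj)
        (qPoch_ne_zero_of_le h2 hj)) (qPoch_ne_zero_of_le h3 hj)) (qPoch_ne_zero_of_le h4 hj)
  have hR : ContinuousAt (fun t => qPoch q (t ^ 2 * q) n * qPoch q (q * t / b) n /
      (qPoch q (q * t) n * qPoch q (t ^ 2 * q / b) n)) s :=
    ContinuousAt.div
      ((hP _ _ (by fun_prop)).mul (hP _ _ (by fun_prop))).continuousAt
      ((hP _ _ (by fun_prop)).mul (hP _ _ (by fun_prop))).continuousAt (mul_ne_zero h5 h3)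
  have hA : ∀ᶠ t in 𝓝[≠] s, ∀ k ∈ Finset.range (2 * n + 1), 1 - t ^ 2 * q ^ k ≠ 0 :=
    (Finset.eventually_all _).2 fun k _ => eventually_one_sub_sq_mul_ne_zero hs _
  have hB : ∀ᶠ t in 𝓝[≠] s, qPoch q (t ^ 2 * q / b) n ≠ 0 :=
    eventually_nhdsWithin_of_eventually_nhds
      ((hP (fun t => t ^ 2 * q / b) n (by fun_prop)).continuousAt.eventually_ne h3)
  refine tendsto_nhds_unique_of_eventuallyEq (hL.mono_left nhdsWithin_le_nhds)
    (hR.mono_left nhdsWithin_le_nhds) (l := 𝓝[≠] s) ?_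
  filter_upwards [hA, hB] with t htA htB
  exact sum_qDixonTerm_of_generic hq hb n
    (fun k hk => htA k (Finset.mem_range.2 (by omega))) h1 htB
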